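/- R(K₃, K₃, K₄) = R(K₃+e, K₃+e, K₅−P₃). -/

import Mathlib

open SimpleGraph

/-- `G` contains a subgraph isomorphic to `H`:
there is an injective map from the vertices of `H` to those of `G` preserving adjacency. -/
def Contains {V W : Type*} (G : SimpleGraph V) (H : SimpleGraph W) : Prop :=
  ∃ f : W → V, Function.Injective f ∧ ∀ ⦃a b : W⦄, H.Adj a b → G.Adj (f a) (f b)

/-- The triangle `K₃`. -/
def triangle : SimpleGraph (Fin 3) := ⊤

/-- The paw graph `K₃ + e`: a triangle `{0, 1, 2}` with a pendant edge `{2, 3}`. -/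
def paw : SimpleGraph (Fin 4) :=
  SimpleGraph.fromEdgeSet {s(0, 1), s(0, 2), s(1, 2), s(2, 3)}

/-- `J₄ = K₄ - e`, the complete graph on 4 vertices with one edge deleted. -/
def J4 : SimpleGraph (Fin 4) := (⊤ : SimpleGraph (Fin 4)).deleteEdges {s(0, 1)}

/-- The graph formed by the edges of color `i` in the edge coloring `c` of `K_n`. -/
def colorClass {n m : ℕ} (c : Sym2 (Fin n) → Fin m) (i : Fin m) : SimpleGraph (Fin n) :=
  SimpleGraph.fromEdgeSet {e | c e = i}

/-- A `(G1, G2, G3; n)`-coloring: a 3-coloring of the edges of `K_n` such that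
color `i` contains no subgraph isomorphic to `Gi`. -/
def GoodColoring3 {a b d : ℕ} (G1 : SimpleGraph (Fin a)) (G2 : SimpleGraph (Fin b))
    (G3 : SimpleGraph (Fin d)) (n : ℕ) : Prop :=
  ∃ c : Sym2 (Fin n) → Fin 3,
    ¬ Contains (colorClass c 0) G1 ∧ ¬ Contains (colorClass c 1) G2 ∧
      ¬ Contains (colorClass c 2) G3

/-- The 3-color Ramsey number `R(G1, G2, G3)`:
the least `n` such that no `(G1, G2, G3; n)`-coloring exists. -/
noncomputable def Ramsey3 {a b d : ℕ} (G1 : SimpleGraph (Fin a)) (G2 : SimpleGraph (Fin b))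
    (G3 : SimpleGraph (Fin d)) : ℕ :=
  sInf {n : ℕ | ¬ GoodColoring3 G1 G2 G3 n}

/-- `K₅ - P₃`: the complete graph on 5 vertices with the two edges of a path
on 3 vertices (two edges sharing the common vertex 0) deleted. -/
def K5minusP3 : SimpleGraph (Fin 5) :=
  (⊤ : SimpleGraph (Fin 5)).deleteEdges {s(0, 1), s(0, 2)}

section RamseyAux

open Finset
open scoped Classical

variable {V : Type*}

/-- Every two distinct vertices of `S` are adjacent in `A` or in `B`. -/
def CoversPairs (A B : SimpleGraph V) (S : Finset V) : Prop :=
  ∀ x ∈ S, ∀ y ∈ S, x ≠ y → A.Adj x y ∨ B.Adj x y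

/-- The restriction of `G` to `S` has no triangle. -/
def TriangleFreeOn (G : SimpleGraph V) (S : Finset V) : Prop :=
  ∀ x ∈ S, ∀ y ∈ S, ∀ z ∈ S, G.Adj x y → G.Adj x z → ¬ G.Adj y z

/-- The restriction of `G` to `S` has no paw. -/
def PawFreeOn (G : SimpleGraph V) (S : Finset V) : Prop :=
  ∀ x ∈ S, ∀ y ∈ S, ∀ z ∈ S, ∀ w ∈ S,
    G.Adj x y → G.Adj x z → G.Adj y z → G.Adj x w → w = y ∨ w = z

/-- The neighbors of `v` in `S`. -/
noncomputable def nbrs (G : SimpleGraph V) (S : Finset V) (v : V) : Finset V :=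
  S.filter (G.Adj v)

/-- The restriction of `G` to `S` has no `K₅ - P₃`: a vertex outside a `K₄` has at most one
neighbor in it. -/
def K5minusP3FreeOn (G : SimpleGraph V) (S : Finset V) : Prop :=
  ∀ K ⊆ S, G.IsNClique 4 K → ∀ x ∈ S, x ∉ K → #(nbrs G K x) ≤ 1

variable {A B C G : SimpleGraph V} {S T : Finset V} {v : V}

lemma mem_nbrs {x : V} : x ∈ nbrs G S v ↔ x ∈ S ∧ G.Adj v x := by
  simp [nbrs]

lemma nbrs_subset : nbrs G S v ⊆ S :=
  filter_subset _ _

lemma isNClique_four {x y z w : V} (hxy : G.Adj x y) (hxz : G.Adj x z) (hxw : G.Adj x w)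
    (hyz : G.Adj y z) (hyw : G.Adj y w) (hzw : G.Adj z w) : G.IsNClique 4 {x, y, z, w} := by
  refine ⟨?_, card_eq_four.2 ⟨x, y, z, w, hxy.ne, hxz.ne, hxw.ne, hyz.ne, hyw.ne, hzw.ne, rfl⟩⟩
  simp [SimpleGraph.isClique_iff, hxy, hxz, hxw, hyz, hyw, hzw]

lemma CoversPairs.mono (h : CoversPairs A B S) (hT : T ⊆ S) : CoversPairs A B T :=
  fun x hx y hy => h x (hT hx) y (hT hy)

lemma CoversPairs.symm (h : CoversPairs A B S) : CoversPairs B A S :=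
  fun x hx y hy hxy => (h x hx y hy hxy).symm

lemma PawFreeOn.mono (h : PawFreeOn G S) (hT : T ⊆ S) : PawFreeOn G T :=
  fun x hx y hy z hz w hw => h x (hT hx) y (hT hy) z (hT hz) w (hT hw)

lemma K5minusP3FreeOn.mono (h : K5minusP3FreeOn G S) (hT : T ⊆ S) : K5minusP3FreeOn G T :=
  fun K hK hc x hx => h K (hK.trans hT) hc x (hT hx)

lemma CoversPairs.card_le (h : CoversPairs A B S) (hv : v ∈ S) :
    #S ≤ 1 + #(nbrs A S v) + #(nbrs B S v) := by
  have hsub : S ⊆ ({v} ∪ nbrs A S v) ∪ nbrs B S v := by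
    intro y hy
    have := h v hv y hy
    simp only [mem_union, mem_singleton, mem_nbrs]
    grind
  calc #S ≤ _ := card_le_card hsub
    _ ≤ _ := card_union_le _ _
    _ ≤ _ := by grw [card_union_le]; simp

lemma card_nbrs_sup_le :
    #(nbrs (A ⊔ B) S v) ≤ #(nbrs A S v) + #(nbrs B S v) := by
  simp only [nbrs, SimpleGraph.sup_adj, filter_or]
  exact card_union_le _ _

/-- `R(K₃, K₃) ≤ 6`. -/
lemma CoversPairs.card_le_five (h : CoversPairs A B S) (hA : TriangleFreeOn A S)
    (hB : TriangleFreeOn B S) : #S ≤ 5 := by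
  by_contra! hS
  obtain ⟨v, hv⟩ : S.Nonempty := card_pos.1 (by omega)
  have key : ∀ {A B : SimpleGraph V}, CoversPairs A B S → TriangleFreeOn A S →
      TriangleFreeOn B S → #(nbrs A S v) ≤ 2 := by
    intro A B h hA hB
    by_contra! h3
    obtain ⟨x, hx, y, hy, z, hz, hxy, hxz, hyz⟩ := two_lt_card.1 h3
    simp only [mem_nbrs] at hx hy hz
    have e {a b : V} (ha : a ∈ S ∧ A.Adj v a) (hb : b ∈ S ∧ A.Adj v b) (hab : a ≠ b) :
        B.Adj a b :=
      (h a ha.1 b hb.1 hab).resolve_left (hA v hv a ha.1 b hb.1 ha.2 hb.2)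
    exact hB x hx.1 y hy.1 z hz.1 (e hx hy hxy) (e hx hz hxz) (e hy hz hyz)
  have := key h hA hB
  have := key h.symm hB hA
  have := h.card_le hv
  omega

lemma PawFreeOn.card_neighbors_le_two (h : PawFreeOn G S) {x y z : V} (hx : x ∈ S) (hy : y ∈ S)
    (hz : z ∈ S) (hxy : G.Adj x y) (hxz : G.Adj x z) (hyz : G.Adj y z) :
    #(nbrs G S x) ≤ 2 := by
  have hsub : nbrs G S x ⊆ {y, z} := by
    intro w hw
    rw [mem_nbrs] at hw
    simpa using h x hx y hy z hz w hw.1 hxy hxz hyz hw.2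
  exact (card_le_card hsub).trans card_le_two

lemma PawFreeOn.not_adj_of_adj (h : PawFreeOn G S) (hv : v ∈ S)
    (hd : 3 ≤ #(nbrs G S v)) {x y : V} (hx : x ∈ S) (hy : y ∈ S) (hvx : G.Adj v x)
    (hvy : G.Adj v y) : ¬ G.Adj x y := by
  intro hxy
  have := h.card_neighbors_le_two hv hx hy hvx hvy hxy
  omega

lemma CoversPairs.triangleFreeOn_of_pawFreeOn (h : CoversPairs A B S) (hA : PawFreeOn A S)
    (hB : PawFreeOn B S) (hS : 7 ≤ #S) : TriangleFreeOn A S := by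
  intro a ha b hb c hc hab hac hbc
  have hcard : 4 ≤ #(S \ {a, b, c}) := by
    have := le_card_sdiff {a, b, c} S
    have : #({a, b, c} : Finset V) ≤ 3 := card_le_three
    omega
  have hout : ∀ x ∈ S \ {a, b, c}, x ∈ S ∧ B.Adj a x ∧ B.Adj b x := by
    intro x hx
    simp only [mem_sdiff, mem_insert, mem_singleton, not_or] at hx
    obtain ⟨hxS, hxa, hxb, hxc⟩ := hx
    refine ⟨hxS, (h a ha x hxS (Ne.symm hxa)).resolve_left fun h' => ?_,
      (h b hb x hxS (Ne.symm hxb)).resolve_left fun h' => ?_⟩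
    · exact (hA a ha b hb c hc x hxS hab hac hbc h').elim hxb hxc
    · exact (hA b hb a ha c hc x hxS hab.symm hbc hac h').elim hxa hxc
  have hAadj : ∀ x ∈ S \ {a, b, c}, ∀ y ∈ S \ {a, b, c}, x ≠ y → A.Adj x y := by
    intro x hx y hy hxy
    obtain ⟨hxS, hax, hbx⟩ := hout x hx
    obtain ⟨hyS, hay, hby⟩ := hout y hy
    refine (h x hxS y hyS hxy).resolve_right fun h' => ?_
    rcases hB x hxS a ha y hyS b hb hax.symm h' hay hbx.symm with rfl | rfl
    · exact hab.ne rfl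
    · exact hby.ne rfl
  obtain ⟨x, hx, y, hy, z, hz, w, hw, hxy, hxz, hxw, hyz, hyw, hzw⟩ :
      ∃ x ∈ S \ {a, b, c}, ∃ y ∈ S \ {a, b, c}, ∃ z ∈ S \ {a, b, c}, ∃ w ∈ S \ {a, b, c},
        x ≠ y ∧ x ≠ z ∧ x ≠ w ∧ y ≠ z ∧ y ≠ w ∧ z ≠ w := by
    obtain ⟨K, hK, hK4⟩ := exists_subset_card_eq hcard
    obtain ⟨x, y, z, w, h1, h2, h3, h4, h5, h6, rfl⟩ := card_eq_four.1 hK4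
    exact ⟨x, hK (by simp), y, hK (by simp), z, hK (by simp), w, hK (by simp),
      h1, h2, h3, h4, h5, h6⟩
  rcases hA x (hout x hx).1 y (hout y hy).1 z (hout z hz).1 w (hout w hw).1 (hAadj x hx y hy hxy)
    (hAadj x hx z hz hxz) (hAadj y hy z hz hyz) (hAadj x hx w hw hxw) with rfl | rfl
  · exact hyw rfl
  · exact hzw rfl

/-- `R(K₃ + e, K₃ + e) ≤ 7`. -/
lemma CoversPairs.card_le_six (h : CoversPairs A B S) (hA : PawFreeOn A S)
    (hB : PawFreeOn B S) : #S ≤ 6 := by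
  by_contra! hS
  have := h.card_le_five (h.triangleFreeOn_of_pawFreeOn hA hB hS)
    (h.symm.triangleFreeOn_of_pawFreeOn hB hA hS)
  omega

lemma CoversPairs.rotate (h : CoversPairs A (B ⊔ C) S) : CoversPairs B (C ⊔ A) S := by
  intro x hx y hy hxy
  have := h x hx y hy hxy
  simp only [SimpleGraph.sup_adj] at *
  tauto

lemma CoversPairs.card_le_sup (h : CoversPairs A (B ⊔ C) S) (hv : v ∈ S) :
    #S ≤ 1 + #(nbrs A S v) + #(nbrs B S v) + #(nbrs C S v) := by
  have h1 := h.card_le hv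
  have h2 := card_nbrs_sup_le (A := B) (B := C) (S := S) (v := v)
  omega

lemma CoversPairs.neighbors (h : CoversPairs A (B ⊔ C) S) (hA : PawFreeOn A S) (hv : v ∈ S)
    (hd : 3 ≤ #(nbrs A S v)) : CoversPairs B C (nbrs A S v) := by
  intro x hx y hy hxy
  rw [mem_nbrs] at hx hy
  exact (h x hx.1 y hy.1 hxy).resolve_left (hA.not_adj_of_adj hv hd hx.1 hy.1 hx.2 hy.2)

/-- `R(K₃ + e, K₃ + e, K₃ + e) ≤ 17`. -/
lemma CoversPairs.card_le_sixteen (h : CoversPairs A (B ⊔ C) S) (hA : PawFreeOn A S)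
    (hB : PawFreeOn B S) (hC : PawFreeOn C S) : #S ≤ 16 := by
  by_contra! hS
  have deg : ∀ {A B C : SimpleGraph V}, CoversPairs A (B ⊔ C) S → PawFreeOn A S →
      PawFreeOn B S → PawFreeOn C S → ∀ v ∈ S, #(nbrs A S v) ≤ 6 := by
    intro A B C h hA hB hC v hv
    by_contra! hd
    have := (h.neighbors hA hv (by omega)).card_le_six (hB.mono nbrs_subset)
      (hC.mono nbrs_subset)
    omega
  have tri : ∀ {A B C : SimpleGraph V}, CoversPairs A (B ⊔ C) S → PawFreeOn A S →
      PawFreeOn B S → PawFreeOn C S → TriangleFreeOn A S := by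
    intro A B C h hA hB hC x hx y hy z hz hxy hxz hyz
    have := hA.card_neighbors_le_two hx hy hz hxy hxz hyz
    have := deg h.rotate hB hC hA x hx
    have := deg h.rotate.rotate hC hA hB x hx
    have := h.card_le_sup hx
    omega
  have deg' : ∀ {A B C : SimpleGraph V}, CoversPairs A (B ⊔ C) S → PawFreeOn A S →
      TriangleFreeOn B S → TriangleFreeOn C S → ∀ v ∈ S, #(nbrs A S v) ≤ 5 := by
    intro A B C h hA hB hC v hv
    by_contra! hd
    have := (h.neighbors hA hv (by omega)).card_le_five
      (fun x hx y hy z hz => hB x (mem_nbrs.1 hx).1 y (mem_nbrs.1 hy).1 z (mem_nbrs.1 hz).1)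
      (fun x hx y hy z hz => hC x (mem_nbrs.1 hx).1 y (mem_nbrs.1 hy).1 z (mem_nbrs.1 hz).1)
    omega
  have tA := tri h hA hB hC
  have tB := tri h.rotate hB hC hA
  have tC := tri h.rotate.rotate hC hA hB
  obtain ⟨v, hv⟩ : S.Nonempty := card_pos.1 (by omega)
  have := deg' h hA tB tC v hv
  have := deg' h.rotate hB tC tA v hv
  have := deg' h.rotate.rotate hC tA tB v hv
  have := h.card_le_sup hv
  omega

lemma K5minusP3FreeOn.pawFreeOn_neighbors (h : K5minusP3FreeOn G S) (hv : v ∈ S) :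
    PawFreeOn G (nbrs G S v) := by
  intro x hx y hy z hz w hw hxy hxz hyz hxw
  rw [mem_nbrs] at hx hy hz hw
  by_contra! hne
  have hK : G.IsNClique 4 {v, x, y, z} := isNClique_four hx.2 hy.2 hz.2 hxy hxz hyz
  have hsub : ({v, x, y, z} : Finset V) ⊆ S := by
    simp [insert_subset_iff, hv, hx.1, hy.1, hz.1]
  have := h _ hsub hK w hw.1 (by simp [hw.2.ne', hxw.ne', hne.1, hne.2])
  have h2 : #({v, x} : Finset V) ≤ #(nbrs G {v, x, y, z} w) := by
    apply card_le_card
    simp [insert_subset_iff, mem_nbrs, hw.2.symm, hxw.symm]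
  rw [card_pair hx.2.ne] at h2
  omega

lemma K5minusP3FreeOn.card_clique_le (h : K5minusP3FreeOn G S) (hT : T ⊆ S)
    (hc : ∀ x ∈ T, ∀ y ∈ T, x ≠ y → G.Adj x y) : #T ≤ 4 := by
  by_contra! hT5
  obtain ⟨K, hK, hK4⟩ := exists_subset_card_eq hT5.le
  obtain ⟨x, hx, hxK⟩ := exists_mem_notMem_of_card_lt_card (hK4 ▸ hT5)
  have := h K (hK.trans hT) ⟨fun a ha b hb hab => hc a (hK ha) b (hK hb) hab, hK4⟩ x (hT hx) hxK
  rw [nbrs, filter_true_of_mem fun y hy => hc x hx y (hK hy) (by rintro rfl; exact hxK hy)] at this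
  omega

lemma CoversPairs.card_neighbors_clique (h : CoversPairs A C S) (hC : K5minusP3FreeOn C S)
    {K : Finset V} (hK : K ⊆ S) (hc : C.IsNClique 4 K) {x : V} (hx : x ∈ S) (hxK : x ∉ K) :
    3 ≤ #(nbrs A K x) := by
  have h1 := hC K hK hc x hx hxK
  have hsub : K ⊆ nbrs A K x ∪ nbrs C K x := by
    intro y hy
    have := h x hx y (hK hy) (by rintro rfl; exact hxK hy)
    simpa [mem_nbrs, hy] using this
  have h2 := (card_le_card hsub).trans (card_union_le _ _)
  have := hc.card_eq
  omega

/-- `R(K₃ + e, K₅ - P₃) ≤ 10`. -/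
lemma CoversPairs.card_le_nine (h : CoversPairs A C S) (hA : PawFreeOn A S)
    (hC : K5minusP3FreeOn C S) : #S ≤ 9 := by
  by_contra! hS
  have tA : TriangleFreeOn A S := by
    intro x hx y hy z hz hxy hxz hyz
    have := hA.card_neighbors_le_two hx hy hz hxy hxz hyz
    have := (h.mono (nbrs_subset (G := C) (v := x))).card_le_six (hA.mono nbrs_subset)
      (hC.pawFreeOn_neighbors hx)
    have := h.card_le hx
    omega
  have noK4 : ∀ K ⊆ S, ¬ C.IsNClique 4 K := by
    intro K hK hc
    have hcl : ∀ x ∈ S \ K, ∀ y ∈ S \ K, x ≠ y → C.Adj x y := by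
      intro x hx y hy hxy
      rw [mem_sdiff] at hx hy
      refine (h x hx.1 y hy.1 hxy).resolve_left fun hadj => ?_
      have hx3 := h.card_neighbors_clique hC hK hc hx.1 hx.2
      have hy3 := h.card_neighbors_clique hC hK hc hy.1 hy.2
      obtain ⟨z, hz⟩ : (nbrs A K x ∩ nbrs A K y).Nonempty := by
        rw [← card_pos]
        have h1 := card_union_add_card_inter (nbrs A K x) (nbrs A K y)
        have h2 := card_le_card
          (union_subset (nbrs_subset (G := A) (S := K) (v := x)) (nbrs_subset (G := A) (v := y)))
        have := hc.card_eq
        omega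
      simp only [mem_inter, mem_nbrs] at hz
      exact tA x hx.1 y hy.1 z (hK hz.1.1) hadj hz.1.2 hz.2.2
    have := hC.card_clique_le sdiff_subset hcl
    have := le_card_sdiff K S
    have := hc.card_eq
    omega
  obtain ⟨v, hv⟩ : S.Nonempty := card_pos.1 (by omega)
  have dA : #(nbrs A S v) ≤ 3 := by
    by_contra! hd
    obtain ⟨K, hK, hK4⟩ := exists_subset_card_eq hd
    refine noK4 K (hK.trans nbrs_subset) ⟨fun x hx y hy hxy => ?_, hK4⟩
    have hx' := mem_nbrs.1 (hK hx)
    have hy' := mem_nbrs.1 (hK hy)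
    exact (h x hx'.1 y hy'.1 hxy).resolve_left (tA v hv x hx'.1 y hy'.1 hx'.2 hy'.2)
  have dC : #(nbrs C S v) ≤ 5 := by
    refine (h.mono nbrs_subset).card_le_five
      (fun x hx y hy z hz => tA x (mem_nbrs.1 hx).1 y (mem_nbrs.1 hy).1 z (mem_nbrs.1 hz).1)
      fun x hx y hy z hz hxy hxz hyz => ?_
    rw [mem_nbrs] at hx hy hz
    refine noK4 {v, x, y, z} ?_ (isNClique_four hx.2 hy.2 hz.2 hxy hxz hyz)
    simp [insert_subset_iff, hv, hx.1, hy.1, hz.1]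
  have := h.card_le hv
  omega

lemma CoversPairs.card_neighbors_le_nine (h : CoversPairs A (B ⊔ C) S) (hA : PawFreeOn A S)
    (hB : PawFreeOn B S) (hC : K5minusP3FreeOn C S) (hv : v ∈ S) :
    #(nbrs A S v) ≤ 9 := by
  by_contra! hd
  have := (h.neighbors hA hv (by omega)).card_le_nine (hB.mono nbrs_subset)
    (hC.mono nbrs_subset)
  omega

lemma CoversPairs.swap (h : CoversPairs A (B ⊔ C) S) : CoversPairs B (A ⊔ C) S :=
  sup_comm C A ▸ h.rotate

lemma CoversPairs.triangleFreeOn (h : CoversPairs A (B ⊔ C) S) (hA : PawFreeOn A S)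
    (hB : PawFreeOn B S) (hC : K5minusP3FreeOn C S) (hS : 29 ≤ #S) : TriangleFreeOn A S := by
  intro x hx y hy z hz hxy hxz hyz
  have := hA.card_neighbors_le_two hx hy hz hxy hxz hyz
  have := h.swap.card_neighbors_le_nine hB hA hC hx
  have := (h.mono (nbrs_subset (G := C) (v := x))).card_le_sixteen (hA.mono nbrs_subset)
    (hB.mono nbrs_subset) (hC.pawFreeOn_neighbors hx)
  have := h.card_le_sup hx
  omega

lemma CoversPairs.not_isNClique_four (h : CoversPairs A (B ⊔ C) S) (hA : PawFreeOn A S)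
    (hB : PawFreeOn B S) (hC : K5minusP3FreeOn C S) (hS : 29 ≤ #S) {K : Finset V} (hK : K ⊆ S) :
    ¬ C.IsNClique 4 K := by
  intro hc
  have hAB : CoversPairs (A ⊔ B) C S := by
    intro x hx y hy hxy
    have := h x hx y hy hxy
    simp only [SimpleGraph.sup_adj] at *
    tauto
  have hcount : #(S \ K) * 3 ≤ #K * 18 := by
    refine card_mul_le_card_mul (A ⊔ B).Adj (fun x hx => ?_) (fun y hy => ?_)
    · rw [mem_sdiff] at hx
      convert hAB.card_neighbors_clique hC hK hc hx.1 hx.2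
      simp [bipartiteAbove, nbrs]
    · have h1 := h.card_neighbors_le_nine hA hB hC (hK hy)
      have h2 := h.swap.card_neighbors_le_nine hB hA hC (hK hy)
      have h3 := card_nbrs_sup_le (A := A) (B := B) (S := S) (v := y)
      have h4 : #(bipartiteBelow (A ⊔ B).Adj (S \ K) y) ≤ #(nbrs (A ⊔ B) S y) := by
        refine card_le_card fun x hx => ?_
        simp only [bipartiteBelow, mem_filter, mem_nbrs, mem_sdiff] at hx ⊢
        exact ⟨hx.1.1, hx.2.symm⟩
      omega
  have := le_card_sdiff K S
  have := hc.card_eq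
  omega

end RamseyAux

section Translation

variable {V : Type*} {G : SimpleGraph V}

lemma pawFreeOn_of_not_contains (h : ¬ Contains G paw) (S : Finset V) : PawFreeOn G S := by
  intro x _ y _ z _ w _ hxy hxz hyz hxw
  by_contra! hne
  refine h ⟨![y, z, x, w], ?_, ?_⟩
  · have := hxy.ne; have := hxz.ne; have := hyz.ne; have := hxw.ne
    intro i j hij
    fin_cases i <;> fin_cases j <;> simp_all
  · intro i j hij
    have := hxy.symm; have := hxz.symm; have := hyz.symm; have := hxw.symm
    fin_cases i <;> fin_cases j <;> simp_all [paw]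

lemma k5minusP3FreeOn_of_not_contains (h : ¬ Contains G K5minusP3) (S : Finset V) :
    K5minusP3FreeOn G S := by
  classical
  intro K _ hK e _ heK
  by_contra! hd
  obtain ⟨x, hx, y, hy, hxy⟩ := Finset.one_lt_card.1 hd
  rw [mem_nbrs] at hx hy
  have hcard : 1 < ((K.erase x).erase y).card := by
    rw [Finset.card_erase_of_mem (by simp [hy.1, hxy.symm]), Finset.card_erase_of_mem hx.1,
      hK.card_eq]
    norm_num
  obtain ⟨z, hz, w, hw, hzw⟩ := Finset.one_lt_card.1 hcard
  simp only [Finset.mem_erase] at hz hw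
  have hne : ∀ u ∈ K, e ≠ u := by rintro u hu rfl; exact heK hu
  have hadj {a b : V} (ha : a ∈ K) (hb : b ∈ K) (hab : a ≠ b) : G.Adj a b := hK.1 ha hb hab
  have h1 := hadj hx.1 hy.1 hxy
  have h2 := hadj hx.1 hz.2.2 hz.2.1.symm
  have h3 := hadj hx.1 hw.2.2 hw.2.1.symm
  have h4 := hadj hy.1 hz.2.2 hz.1.symm
  have h5 := hadj hy.1 hw.2.2 hw.1.symm
  have h6 := hadj hz.2.2 hw.2.2 hzw
  have e1 := hne x hx.1
  have e2 := hne y hy.1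
  have e3 := hne z hz.2.2
  have e4 := hne w hw.2.2
  have h7 := hx.2
  have h8 := hy.2
  clear hne hadj hcard hd hx hy hz hw hK
  refine h ⟨![e, z, w, x, y], ?_, ?_⟩
  · have := h1.ne; have := h2.ne; have := h3.ne; have := h4.ne; have := h5.ne
    intro i j hij
    fin_cases i <;> fin_cases j <;> simp_all
  · intro i j hij
    have := h1.symm; have := h2.symm; have := h3.symm; have := h4.symm; have := h5.symm
    have := h6.symm; have := h7.symm; have := h8.symm
    fin_cases i <;> fin_cases j <;> simp_all [K5minusP3]

lemma Contains.trans {U W : Type*} {H : SimpleGraph U} {F : SimpleGraph W} (h : Contains G H)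
    (hF : Contains H F) : Contains G F := by
  obtain ⟨f, hf, hf'⟩ := h
  obtain ⟨g, hg, hg'⟩ := hF
  exact ⟨f ∘ g, hf.comp hg, fun a b hab => hf' (hg' hab)⟩

lemma paw_contains_triangle : Contains paw triangle := by
  refine ⟨Fin.castSucc, Fin.castSucc_injective 3, fun a b hab => ?_⟩
  fin_cases a <;> fin_cases b <;> simp_all [paw, triangle]

lemma K5minusP3_contains_K4 : Contains K5minusP3 (⊤ : SimpleGraph (Fin 4)) := by
  refine ⟨Fin.succ, Fin.succ_injective 4, fun a b hab => ?_⟩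
  fin_cases a <;> fin_cases b <;> simp_all [K5minusP3]

lemma colorClass_adj {n m : ℕ} (c : Sym2 (Fin n) → Fin m) (i : Fin m) (x y : Fin n) :
    (colorClass c i).Adj x y ↔ c s(x, y) = i ∧ x ≠ y := by
  simp [colorClass]

lemma goodColoring3_of_paw {n : ℕ} (hn : 29 ≤ n) (h : GoodColoring3 paw paw K5minusP3 n) :
    GoodColoring3 triangle triangle (⊤ : SimpleGraph (Fin 4)) n := by
  obtain ⟨c, h0, h1, h2⟩ := h
  have hS : 29 ≤ (Finset.univ : Finset (Fin n)).card := by simpa using hn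
  have hA := pawFreeOn_of_not_contains h0 Finset.univ
  have hB := pawFreeOn_of_not_contains h1 Finset.univ
  have hC := k5minusP3FreeOn_of_not_contains h2 Finset.univ
  have hcov : CoversPairs (colorClass c 0) (colorClass c 1 ⊔ colorClass c 2) Finset.univ := by
    intro x _ y _ hxy
    simp only [SimpleGraph.sup_adj, colorClass_adj]
    have : ∀ i : Fin 3, i = 0 ∨ i = 1 ∨ i = 2 := by decide
    have := this (c s(x, y))
    tauto
  have tri {G : SimpleGraph (Fin n)} (hG : TriangleFreeOn G Finset.univ) :
      ¬ Contains G triangle := by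
    rintro ⟨f, -, hf⟩
    exact hG (f 0) (by simp) (f 1) (by simp) (f 2) (by simp) (hf (by simp [triangle]))
      (hf (by simp [triangle])) (hf (by simp [triangle]))
  refine ⟨c, tri (hcov.triangleFreeOn hA hB hC hS), tri (hcov.swap.triangleFreeOn hB hA hC hS), ?_⟩
  rintro ⟨f, -, hf⟩
  exact hcov.not_isNClique_four hA hB hC hS (Finset.subset_univ _)
    (isNClique_four (hf (a := 0) (b := 1) (by simp)) (hf (a := 0) (b := 2) (by simp))
      (hf (a := 0) (b := 3) (by simp)) (hf (a := 1) (b := 2) (by simp))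
      (hf (a := 1) (b := 3) (by simp)) (hf (a := 2) (b := 3) (by simp)))

/-- The color of a difference in a cyclic `(K₃, K₃, K₄; 29)`-coloring. -/
def cyclicColor (d : Fin 29) : Fin 3 :=
  ![2, 1, 0, 2, 1, 0, 2, 2, 0, 0, 1, 2, 1, 2, 2, 2, 2, 1, 2, 1, 0, 0, 2, 2, 0, 1, 2, 0, 1] d

lemma cyclicColor_neg (d : Fin 29) : cyclicColor (-d) = cyclicColor d := by
  revert d; decide

/-- The cyclic coloring, restricted to the first `n` vertices. -/
def cyclicColoring {n : ℕ} (hn : n ≤ 29) : Sym2 (Fin n) → Fin 3 :=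
  Sym2.lift ⟨fun x y => cyclicColor (x.castLE hn - y.castLE hn), fun x y => by
    beta_reduce
    rw [← cyclicColor_neg, neg_sub]⟩

lemma cyclicColor_triangle_free : ∀ i : Fin 3, i ≠ 2 → ∀ x : Fin 29, cyclicColor x = i →
    ∀ y : Fin 29, cyclicColor y = i → cyclicColor (x - y) ≠ i := by
  decide +kernel

lemma cyclicColor_K4_free : ∀ x : Fin 29, x ≠ 0 → cyclicColor x = 2 →
    ∀ y : Fin 29, y ≠ 0 → cyclicColor y = 2 → x ≠ y → cyclicColor (x - y) = 2 →
    ∀ z : Fin 29, z ≠ 0 → cyclicColor z = 2 → x ≠ z → cyclicColor (x - z) = 2 → y ≠ z →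
    cyclicColor (y - z) ≠ 2 := by
  decide +kernel

lemma colorClass_cyclicColoring {n : ℕ} (hn : n ≤ 29) {i : Fin 3} {x y : Fin n}
    (h : (colorClass (cyclicColoring hn) i).Adj x y) :
    cyclicColor (x.castLE hn - y.castLE hn) = i ∧ x.castLE hn ≠ y.castLE hn := by
  rw [colorClass_adj] at h
  exact ⟨h.1, fun h' => h.2 (Fin.castLE_injective hn h')⟩

lemma goodColoring3_of_le {n : ℕ} (hn : n ≤ 29) :
    GoodColoring3 triangle triangle (⊤ : SimpleGraph (Fin 4)) n := by
  have tri (i : Fin 3) (hi : i ≠ 2) : ¬ Contains (colorClass (cyclicColoring hn) i) triangle := by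
    rintro ⟨f, -, hf⟩
    obtain ⟨h1, -⟩ := colorClass_cyclicColoring hn (hf (show triangle.Adj 1 0 by simp [triangle]))
    obtain ⟨h2, -⟩ := colorClass_cyclicColoring hn (hf (show triangle.Adj 2 0 by simp [triangle]))
    obtain ⟨h3, -⟩ := colorClass_cyclicColoring hn (hf (show triangle.Adj 1 2 by simp [triangle]))
    have := cyclicColor_triangle_free i hi _ h1 _ h2
    rw [sub_sub_sub_cancel_right] at this
    exact this h3
  refine ⟨cyclicColoring hn, tri 0 (by decide), tri 1 (by decide), ?_⟩
  rintro ⟨f, -, hf⟩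
  have key {i j : Fin 4} (hij : i ≠ j) := colorClass_cyclicColoring hn (hf (a := i) (b := j) hij)
  obtain ⟨h1, n1⟩ := key (show (1 : Fin 4) ≠ 0 by decide)
  obtain ⟨h2, n2⟩ := key (show (2 : Fin 4) ≠ 0 by decide)
  obtain ⟨h3, n3⟩ := key (show (3 : Fin 4) ≠ 0 by decide)
  obtain ⟨h4, n4⟩ := key (show (1 : Fin 4) ≠ 2 by decide)
  obtain ⟨h5, n5⟩ := key (show (1 : Fin 4) ≠ 3 by decide)
  obtain ⟨h6, n6⟩ := key (show (2 : Fin 4) ≠ 3 by decide)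
  have := cyclicColor_K4_free _ (sub_ne_zero.2 n1) h1 _ (sub_ne_zero.2 n2) h2
    (by rwa [Ne, sub_left_inj]) (by rwa [sub_sub_sub_cancel_right]) _ (sub_ne_zero.2 n3) h3
    (by rwa [Ne, sub_left_inj]) (by rwa [sub_sub_sub_cancel_right]) (by rwa [Ne, sub_left_inj])
  rw [sub_sub_sub_cancel_right] at this
  exact this h6

end Translation

/-- `R(K₃, K₃, K₄) = R(K₃+e, K₃+e, K₅-P₃)`. -/
theorem ramsey_K3_K3_K4_eq_ramsey_paw_paw_K5mP3 :
    Ramsey3 triangle triangle (⊤ : SimpleGraph (Fin 4)) =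
      Ramsey3 paw paw K5minusP3 := by
  have hiff (n : ℕ) : GoodColoring3 triangle triangle (⊤ : SimpleGraph (Fin 4)) n ↔
      GoodColoring3 paw paw K5minusP3 n := by
    constructor
    · rintro ⟨c, h0, h1, h2⟩
      exact ⟨c, fun h => h0 (h.trans paw_contains_triangle),
        fun h => h1 (h.trans paw_contains_triangle), fun h => h2 (h.trans K5minusP3_contains_K4)⟩
    · intro h
      rcases le_total n 29 with hn | hn
      · exact goodColoring3_of_le hn
      · exact goodColoring3_of_paw hn h
  simp only [Ramsey3, hiff]
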